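/- Let F be a finite field with q elements invertible in a field k, and 0 ≤ r ≤ n-1. The element η_r = q^{-(n-1)r} μ(r) Σ_m μ(srk m) [n-1-rank m choose r - rank m]_q [m], summed over semi-idempotent n×n matrices m over F of rank ≤ r, is the unit of the two-sided ideal a_{n,r} ⊆ k[M_n] spanned by matrices of rank at most r: η_r x = x η_r = x for all x ∈ a_{n,r}. -/

import Mathlib

open Polynomial

section

variable {F : Type*} [Field F] {n : ℕ}

/-- A square matrix is semi-idempotent iff its minimal polynomial divides
`x^ℓ (x - 1)` for some `ℓ`. -/
def IsSemiIdempotent (m : Matrix (Fin n) (Fin n) F) : Prop :=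
  ∃ ℓ : ℕ, minpoly F m ∣ X ^ ℓ * (X - 1)

/-- The stable rank of an `n×n` matrix: the rank of `m^N` for `N` large
(the rank sequence stabilizes by index `n`). -/
noncomputable def srk (m : Matrix (Fin n) (Fin n) F) : ℕ :=
  Matrix.rank (m ^ n)

end

/-- The quantity `μ(j) = (-1)^j q^(C(j,2))`, as an element of `k`. -/
def muq (k : Type*) [Field k] (q j : ℕ) : k := (-1) ^ j * (q : k) ^ (j.choose 2)

/-- The Gaussian binomial coefficient `[a choose b]_q` evaluated at `q ∈ k`,
via the `q`-Pascal recursion `[a+1, b+1] = [a, b] + q^(b+1) [a, b+1]`. -/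
def qbinomEval {k : Type*} [Field k] (q : k) : ℕ → ℕ → k
  | _, 0 => 1
  | 0, _ + 1 => 0
  | a + 1, b + 1 => qbinomEval q a b + q ^ (b + 1) * qbinomEval q a (b + 1)

/-- The element
`η_r = q^{-(n-1)r} μ(r) ∑_m μ(srk m) [n-1-rank m choose r-rank m]_q [m]`
of `k[M_n]`, summed over semi-idempotent matrices `m` of rank at most `r`. -/
noncomputable def etaR (F : Type*) [Field F] [Fintype F] (n r : ℕ)
    (k : Type*) [Field k] :
    MonoidAlgebra k (Matrix (Fin n) (Fin n) F) :=
  open scoped Classical in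
  ((((Fintype.card F : k)) ^ ((n - 1) * r))⁻¹ * muq k (Fintype.card F) r) •
    ∑ m : Matrix (Fin n) (Fin n) F,
      if IsSemiIdempotent m ∧ Matrix.rank m ≤ r then
        (muq k (Fintype.card F) (srk m) *
            qbinomEval (Fintype.card F : k) (n - 1 - Matrix.rank m) (r - Matrix.rank m)) •
          MonoidAlgebra.single m (1 : k)
      else 0


open Matrix

section helpers

variable {F : Type*} [Field F]

theorem semi_iff {n : ℕ} (m : Matrix (Fin n) (Fin n) F) :
    IsSemiIdempotent m ↔ ∃ ℓ : ℕ, m ^ ℓ * (m - 1) = 0 := by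
  unfold IsSemiIdempotent
  refine exists_congr fun ℓ => ?_
  rw [minpoly.dvd_iff]
  simp

theorem mul_pow_swap {n p : ℕ} (A : Matrix (Fin n) (Fin p) F) (B : Matrix (Fin p) (Fin n) F)
    (N : ℕ) : (A * B) ^ (N + 1) = A * (B * A) ^ N * B := by
  induction N with
  | zero => simp
  | succ N ih =>
    rw [pow_succ, ih, pow_succ]
    simp only [Matrix.mul_assoc]

theorem semi_swap {n p : ℕ} (A : Matrix (Fin n) (Fin p) F) (B : Matrix (Fin p) (Fin n) F)
    (h : IsSemiIdempotent (A * B)) : IsSemiIdempotent (B * A) := by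
  rw [semi_iff] at h ⊢
  obtain ⟨ℓ, h⟩ := h
  refine ⟨ℓ + 1, ?_⟩
  have : (B * A) ^ (ℓ + 1) * (B * A - 1) = B * ((A * B) ^ ℓ * (A * B - 1)) * A := by
    rw [mul_pow_swap]
    simp only [Matrix.mul_sub, Matrix.sub_mul, Matrix.mul_assoc, Matrix.mul_one]
  rw [this, h]; simp

theorem rank_pow_stable {n : ℕ} (m : Matrix (Fin n) (Fin n) F) (N : ℕ) (hN : n ≤ N) :
    (m ^ N).rank = (m ^ n).rank := by
  have key : ∀ j : ℕ, (m ^ j).rank + Module.finrank F (LinearMap.ker ((Matrix.toLin' m) ^ j)) = n := by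
    intro j
    have h := LinearMap.finrank_range_add_finrank_ker ((Matrix.toLin' m) ^ j)
    rw [Module.finrank_fin_fun] at h
    have h' : (m ^ j).rank = Module.finrank F (LinearMap.range ((Matrix.toLin' m) ^ j)) := by
      rw [← Matrix.toLin'_pow]
      rfl
    rw [h', h]
  have h1 := key N
  have h2 := key n
  have h3 := Module.End.ker_pow_eq_ker_pow_finrank_of_le (f := Matrix.toLin' m) (m := N)
    (by simpa using hN)
  rw [Module.finrank_fin_fun] at h3
  rw [h3] at h1
  omega

theorem srk_swap {n p : ℕ} (A : Matrix (Fin n) (Fin p) F) (B : Matrix (Fin p) (Fin n) F) :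
    srk (A * B) = srk (B * A) := by
  have key : ∀ {n p : ℕ} (A : Matrix (Fin n) (Fin p) F) (B : Matrix (Fin p) (Fin n) F),
      srk (A * B) ≤ srk (B * A) := by
    intro n p A B
    unfold srk
    rw [← rank_pow_stable (A * B) (n + p + 1) (by omega), ← rank_pow_stable (B * A) (n + p) (by omega),
      mul_pow_swap]
    exact (Matrix.rank_mul_le_left _ _).trans (Matrix.rank_mul_le_right _ _)
  exact le_antisymm (key A B) (key B A)

open scoped Classical in
/-- The weight `μ(srk m)` on semi-idempotents, zero elsewhere. -/
noncomputable def wt (k : Type*) [Field k] (q : ℕ) {n : ℕ} (m : Matrix (Fin n) (Fin n) F) : k :=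
  if IsSemiIdempotent m then muq k q (srk m) else 0

variable (k : Type*) [Field k] (q : ℕ)

theorem wt_swap {n p : ℕ} (A : Matrix (Fin n) (Fin p) F) (B : Matrix (Fin p) (Fin n) F) :
    wt k q (A * B) = wt k q (B * A) := by
  unfold wt
  rw [srk_swap]
  have : IsSemiIdempotent (A * B) ↔ IsSemiIdempotent (B * A) := ⟨semi_swap A B, semi_swap B A⟩
  by_cases h : IsSemiIdempotent (A * B)
  · rw [if_pos h, if_pos (this.1 h)]
  · rw [if_neg h, if_neg (fun h' => h (this.2 h'))]

theorem wt_one (n : ℕ) : wt k q (1 : Matrix (Fin n) (Fin n) F) = muq k q n := by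
  unfold wt
  rw [if_pos ((semi_iff _).2 ⟨0, by simp⟩)]
  simp [srk]

theorem wt_unit {n : ℕ} (m : Matrix (Fin n) (Fin n) F) (hm : m.det ≠ 0) (h1 : m ≠ 1) :
    wt k q m = 0 := by
  unfold wt
  rw [if_neg]
  rw [semi_iff]
  rintro ⟨ℓ, h⟩
  apply h1
  have hu : IsUnit (m ^ ℓ) := by
    apply IsUnit.pow
    rw [Matrix.isUnit_iff_isUnit_det]
    exact isUnit_iff_ne_zero.2 hm
  rw [hu.mul_right_eq_zero] at h
  exact sub_eq_zero.1 h

theorem semi_transpose {n : ℕ} (m : Matrix (Fin n) (Fin n) F) :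
    IsSemiIdempotent mᵀ ↔ IsSemiIdempotent m := by
  have key : ∀ m : Matrix (Fin n) (Fin n) F, IsSemiIdempotent m → IsSemiIdempotent mᵀ := by
    intro m h
    rw [semi_iff] at h ⊢
    obtain ⟨ℓ, h⟩ := h
    refine ⟨ℓ, ?_⟩
    have h2 := congrArg Matrix.transpose h
    rw [Matrix.transpose_mul, Matrix.transpose_pow, Matrix.transpose_sub, Matrix.transpose_one,
      Matrix.transpose_zero] at h2
    rw [← h2]
    rw [mul_sub, sub_mul, ← pow_succ, ← pow_succ']; simp
  exact ⟨fun h => by simpa using key _ h, key m⟩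

theorem srk_transpose {n : ℕ} (m : Matrix (Fin n) (Fin n) F) : srk mᵀ = srk m := by
  unfold srk
  rw [← Matrix.transpose_pow, Matrix.rank_transpose]

theorem wt_transpose {n : ℕ} (m : Matrix (Fin n) (Fin n) F) : wt k q mᵀ = wt k q m := by
  unfold wt
  rw [srk_transpose]
  by_cases h : IsSemiIdempotent m
  · rw [if_pos h, if_pos ((semi_transpose m).2 h)]
  · rw [if_neg h, if_neg (fun h' => h ((semi_transpose m).1 h'))]

theorem muq_succ (j : ℕ) : muq k q (j + 1) = - ((q : k) ^ j * muq k q j) := by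
  unfold muq
  rw [Nat.choose_succ_succ' j 1, pow_add, pow_succ, Nat.choose_one_right]
  ring

/-- Explicit quotient by a line. -/
theorem exists_quot {n : ℕ} (u : Fin (n + 1) → F) (hu : u ≠ 0) :
    ∃ (Q : Matrix (Fin n) (Fin (n + 1)) F) (R : Matrix (Fin (n + 1)) (Fin n) F)
      (ρ : Fin (n + 1) → F), Q * R = 1 ∧ Q *ᵥ u = 0 ∧ R * Q = 1 - vecMulVec u ρ := by
  obtain ⟨i, hi⟩ := Function.ne_iff.1 hu
  simp only [Pi.zero_apply] at hi
  refine ⟨Matrix.of fun j l => (if l = i.succAbove j then 1 else 0) -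
      (if l = i then u (i.succAbove j) / u i else 0),
    Matrix.of fun l j => if l = i.succAbove j then 1 else 0,
    fun l => if l = i then (u i)⁻¹ else 0, ?_, ?_, ?_⟩
  · ext a b
    rw [Matrix.mul_apply, Fin.sum_univ_succAbove _ i]
    simp [Matrix.one_apply, eq_comm]
  · ext a
    rw [Matrix.mulVec, dotProduct, Fin.sum_univ_succAbove _ i]
    simp [Fin.succAbove_ne, hi, Fin.ne_succAbove]
  · ext a b
    rw [Matrix.mul_apply]
    simp only [Matrix.of_apply, Matrix.sub_apply, vecMulVec_apply, Matrix.one_apply]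
    rcases Fin.eq_self_or_eq_succAbove i a with rfl | ⟨a, rfl⟩
    · rcases Fin.eq_self_or_eq_succAbove a b with rfl | ⟨b, rfl⟩
      · simp [hi, Fin.ne_succAbove]
      · simp [Fin.ne_succAbove, Fin.succAbove_ne]
    · rcases Fin.eq_self_or_eq_succAbove i b with rfl | ⟨b, rfl⟩
      · simp [Fin.ne_succAbove, Fin.succAbove_ne, div_eq_mul_inv]
      · simp [Fin.ne_succAbove, eq_comm]

theorem card_sum_surj {G H K : Type*} [AddCommGroup G] [AddCommGroup H] [Fintype G] [Fintype H]
    [AddCommGroup K] (f : G →+ H) (hf : Function.Surjective f) (g : H → K) :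
    Fintype.card H • ∑ x : G, g (f x) = Fintype.card G • ∑ h : H, g h := by
  have h1 : ∀ h : H, ∑ x : G, g (f x) = ∑ x : G, g (f x + h) := by
    intro h
    obtain ⟨y, rfl⟩ := hf h
    rw [← Equiv.sum_comp (Equiv.addRight y)]
    simp
  calc Fintype.card H • ∑ x : G, g (f x) = ∑ h : H, ∑ x : G, g (f x) := by simp
    _ = ∑ h : H, ∑ x : G, g (f x + h) := Finset.sum_congr rfl fun h _ => h1 h
    _ = ∑ x : G, ∑ h : H, g (f x + h) := Finset.sum_comm
    _ = ∑ x : G, ∑ h : H, g h := by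
        refine Finset.sum_congr rfl fun x _ => ?_
        exact Equiv.sum_comp (Equiv.addLeft (f x)) g
    _ = _ := by simp

end helpers

section key

variable {F : Type*} [Field F]

/-- If no nonzero row kills both `m` and `v`, and `v` is in the image of `m + v λ`, then
`m + v λ` is invertible. -/
theorem det_ne_of_mem {n : ℕ} (m : Matrix (Fin n) (Fin n) F) (v lam y : Fin n → F)
    (hX : ∀ ξ : Fin n → F, ξ ᵥ* m = 0 → ξ ⬝ᵥ v = 0 → ξ = 0)
    (c : F) (hc : c ≠ 0) (hy : (m + vecMulVec v lam) *ᵥ y = c • v) :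
    (m + vecMulVec v lam).det ≠ 0 := by
  intro h
  obtain ⟨ξ, hξ, h0⟩ := Matrix.exists_vecMul_eq_zero_iff.2 h
  have h1 : ξ ⬝ᵥ v = 0 := by
    have h2 := congrArg (fun w => ξ ⬝ᵥ w) hy
    simp only [Matrix.dotProduct_mulVec, h0, zero_dotProduct, dotProduct_smul, smul_eq_mul] at h2
    exact (mul_eq_zero.1 h2.symm).resolve_left hc
  apply hξ
  apply hX ξ _ h1
  rw [Matrix.vecMul_add, Matrix.vecMul_vecMulVec, h1] at h0
  simpa using h0

variable [Fintype F] (k : Type*) [Field k]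

theorem key_right_base {n : ℕ}
    (m : Matrix (Fin (n + 1)) (Fin (n + 1)) F) (v : Fin (n + 1) → F)
    (hX : ∀ ξ : Fin (n + 1) → F, ξ ᵥ* m = 0 → ξ ⬝ᵥ v = 0 → ξ = 0)
    (hv : v ≠ 0) (hm : m *ᵥ v = 0) :
    ∑ lam : Fin (n + 1) → F, wt k (Fintype.card F) (m + vecMulVec v lam) = 0 := by
  classical
  obtain ⟨Q, R, ρ, hQR, hQv, hRQ⟩ := exists_quot v hv
  have hρ : ρ ⬝ᵥ v = 1 := by
    have h := congrArg (fun M => M *ᵥ v) hRQ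
    simp only [← Matrix.mulVec_mulVec, hQv, Matrix.mulVec_zero, Matrix.sub_mulVec,
      Matrix.one_mulVec, Matrix.vecMulVec_mulVec] at h
    have h2 : (1 - ρ ⬝ᵥ v) • v = 0 := by
      rw [sub_smul, one_smul]
      simpa using h.symm
    have := (smul_eq_zero.1 h2).resolve_right hv
    exact (sub_eq_zero.1 this).symm
  have hmRQ : m * R * Q = m := by
    rw [Matrix.mul_assoc, hRQ, Matrix.mul_sub, Matrix.mul_vecMulVec, hm]
    simp
  have hvl : ∀ lam : Fin (n + 1) → F, (m + vecMulVec v lam) *ᵥ v = (lam ⬝ᵥ v) • v := by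
    intro lam
    rw [Matrix.add_mulVec, hm, Matrix.vecMulVec_mulVec]
    simp
  have hl0 : ∀ lam : Fin (n + 1) → F, lam ⬝ᵥ v = 0 → lam ᵥ* R ᵥ* Q = lam := by
    intro lam h
    rw [Matrix.vecMul_vecMul, hRQ, Matrix.vecMul_sub, Matrix.vecMul_vecMulVec, h]
    simp
  have hdet : (Q * (m * R)).det ≠ 0 := by
    intro h
    obtain ⟨ξ, hξ, h0⟩ := Matrix.exists_vecMul_eq_zero_iff.2 h
    apply hξ
    have h1 : ξ ᵥ* Q = 0 := by
      apply hX
      · rw [← hmRQ, Matrix.vecMul_vecMul, ← Matrix.mul_assoc, ← Matrix.vecMul_vecMul, h0]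
        simp
      · rw [← Matrix.dotProduct_mulVec, hQv]; simp
    have h2 := congrArg (fun w => w ᵥ* R) h1
    simpa [Matrix.vecMul_vecMul, hQR] using h2
  have hQmR1 : ∀ lam : Fin (n + 1) → F, Q * ((m + vecMulVec v lam) * R) = Q * (m * R) := by
    intro lam
    rw [Matrix.add_mul, Matrix.mul_add, Matrix.vecMulVec_mul, Matrix.mul_vecMulVec, hQv]
    simp
  have hterm : ∀ lam : Fin (n + 1) → F, wt k (Fintype.card F) (m + vecMulVec v lam) =
      (if lam ⬝ᵥ v = 0 then wt k (Fintype.card F) (Q * (m * R)) else 0) +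
      (if m + vecMulVec v lam = 1 then muq k (Fintype.card F) (n + 1) else 0) := by
    intro lam
    by_cases h : lam ⬝ᵥ v = 0
    · rw [if_pos h, if_neg, add_zero, ← hQmR1 lam, ← wt_swap]
      · congr 1
        rw [Matrix.add_mul, Matrix.add_mul, hmRQ, Matrix.vecMulVec_mul, Matrix.vecMulVec_mul, hl0 _ h]
      · intro h1
        have := hvl lam
        rw [h1, h] at this
        simp at this
        exact hv this
    · rw [if_neg h, zero_add]
      split_ifs with h1
      · rw [h1, wt_one]
      · exact wt_unit _ _ _ (det_ne_of_mem m v lam v hX _ h (hvl lam)) h1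
  have hcount : (∑ lam : Fin (n + 1) → F, if lam ⬝ᵥ v = 0 then (1 : k) else 0) =
      (Fintype.card F : k) ^ n := by
    rw [← Fintype.sum_of_injective (fun l : Fin n → F => l ᵥ* Q) ?_ (fun _ => (1 : k))]
    · simp
    · intro l hl
      apply if_neg
      intro h
      exact hl ⟨l ᵥ* R, hl0 l h⟩
    · intro l
      rw [if_pos]
      rw [← Matrix.dotProduct_mulVec, hQv]; simp
    · intro a b hab
      have h2 := congrArg (fun w => w ᵥ* R) hab
      simpa [Matrix.vecMul_vecMul, hQR] using h2
  rw [Finset.sum_congr rfl fun lam _ => hterm lam, Finset.sum_add_distrib]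
  have e1 : (∑ lam : Fin (n + 1) → F, if lam ⬝ᵥ v = 0 then
      wt k (Fintype.card F) (Q * (m * R)) else 0) =
      (Fintype.card F : k) ^ n * wt k (Fintype.card F) (Q * (m * R)) := by
    rw [← hcount, Finset.sum_mul]
    refine Finset.sum_congr rfl fun l _ => ?_
    split_ifs <;> simp
  rw [e1]
  by_cases h1 : Q * (m * R) = 1
  · have h2 : m = 1 - vecMulVec v ρ + vecMulVec v (ρ ᵥ* m) := by
      have h3 := congrArg (fun M => R * M * Q) h1
      simp only [Matrix.mul_one] at h3
      have h4 : R * (Q * (m * R)) * Q = (R * Q) * (m * R * Q) := by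
        simp only [Matrix.mul_assoc]
      rw [h4, hmRQ, hRQ, Matrix.sub_mul, Matrix.vecMulVec_mul, Matrix.one_mul] at h3
      rw [← h3]; simp
    have h3 : ∀ lam : Fin (n + 1) → F, m + vecMulVec v lam = 1 ↔ lam = ρ - ρ ᵥ* m := by
      intro lam
      constructor
      · intro h
        rw [← h] at h2
        have h5 : vecMulVec v (lam - (ρ - ρ ᵥ* m)) = 0 := by
          rw [Matrix.vecMulVec_sub, Matrix.vecMulVec_sub]
          have h6 := sub_eq_zero.2 h2
          rw [← neg_eq_zero, ← h6]
          abel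
        have := (Matrix.vecMulVec_eq_zero.1 h5).resolve_left hv
        exact sub_eq_zero.1 this
      · rintro rfl
        rw [Matrix.vecMulVec_sub]
        nth_rw 1 [h2]
        abel
    simp only [h3]
    rw [h1, wt_one, Finset.sum_ite_eq' , if_pos (Finset.mem_univ _), muq_succ]
    ring
  · rw [wt_unit _ _ _ hdet h1, mul_zero, zero_add]
    apply Finset.sum_eq_zero
    intro lam _
    apply if_neg
    intro h
    apply h1
    rw [← hQmR1 lam, h, Matrix.one_mul, hQR]

theorem key_right (hq : (Fintype.card F : k) ≠ 0) (n : ℕ) :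
    ∀ (m : Matrix (Fin n) (Fin n) F) (v : Fin n → F), v ≠ 0 →
    ∑ lam : Fin n → F, wt k (Fintype.card F) (m + vecMulVec v lam) = 0 := by
  classical
  induction n with
  | zero => intro m v hv; exact absurd (Subsingleton.elim _ _) hv
  | succ n ih =>
    intro m v hv
    by_cases hX : ∀ ξ : Fin (n + 1) → F, ξ ᵥ* m = 0 → ξ ⬝ᵥ v = 0 → ξ = 0
    · -- the spanning case
      have hu : ∃ u : Fin (n + 1) → F, u ≠ 0 ∧ ∃ c : F, m *ᵥ u = c • v := by
        by_cases hd : m.det = 0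
        · obtain ⟨u, hu, h⟩ := Matrix.exists_mulVec_eq_zero_iff.2 hd
          exact ⟨u, hu, 0, by simpa using h⟩
        · have h1 : m *ᵥ (m⁻¹ *ᵥ v) = v := by
            rw [Matrix.mulVec_mulVec, Matrix.mul_nonsing_inv _ (isUnit_iff_ne_zero.2 hd),
              Matrix.one_mulVec]
          refine ⟨m⁻¹ *ᵥ v, ?_, 1, by simpa using h1⟩
          intro h
          rw [h] at h1
          simp at h1
          exact hv h1.symm
      obtain ⟨u, hu, c, hc⟩ := hu
      -- shift so that `m u = 0`
      obtain ⟨l0, hl0⟩ : ∃ l0 : Fin (n + 1) → F, l0 ⬝ᵥ u = -c := by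
        obtain ⟨i, hi⟩ := Function.ne_iff.1 hu
        refine ⟨Pi.single i (-c / u i), ?_⟩
        rw [single_dotProduct]
        exact div_mul_cancel₀ _ hi
      rw [← Equiv.sum_comp (Equiv.addLeft l0)]
      have hsh : ∀ l : Fin (n + 1) → F, m + vecMulVec v (Equiv.addLeft l0 l) =
          (m + vecMulVec v l0) + vecMulVec v l := by
        intro l
        simp only [Equiv.coe_addLeft]
        rw [Matrix.vecMulVec_add, add_assoc]
      simp only [hsh]
      have hX' : ∀ ξ : Fin (n + 1) → F, ξ ᵥ* (m + vecMulVec v l0) = 0 → ξ ⬝ᵥ v = 0 → ξ = 0 := by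
        intro ξ h1 h2
        apply hX ξ _ h2
        rw [Matrix.vecMul_add, Matrix.vecMul_vecMulVec, h2] at h1
        simpa using h1
      have hm' : (m + vecMulVec v l0) *ᵥ u = 0 := by
        rw [Matrix.add_mulVec, hc, Matrix.vecMulVec_mulVec, hl0]
        simp
      generalize m + vecMulVec v l0 = m' at hX' hm'
      by_cases huv : ∃ a : F, v = a • u
      · obtain ⟨a, ha⟩ := huv
        apply key_right_base k m' v hX' hv
        rw [ha, Matrix.mulVec_smul, hm', smul_zero]
      · obtain ⟨Q, R, ρ, hQR, hQu, hRQ⟩ := exists_quot u hu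
        have hmRQ : m' * R * Q = m' := by
          rw [Matrix.mul_assoc, hRQ, Matrix.mul_sub, Matrix.mul_vecMulVec, hm']
          simp
        have hl0 : ∀ lam : Fin (n + 1) → F, lam ⬝ᵥ u = 0 → lam ᵥ* R ᵥ* Q = lam := by
          intro lam h
          rw [Matrix.vecMul_vecMul, hRQ, Matrix.vecMul_sub, Matrix.vecMul_vecMulVec, h]
          simp
        have hvl : ∀ lam : Fin (n + 1) → F, (m' + vecMulVec v lam) *ᵥ u = (lam ⬝ᵥ u) • v := by
          intro lam
          rw [Matrix.add_mulVec, hm', Matrix.vecMulVec_mulVec]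
          simp
        have hQv : Q *ᵥ v ≠ 0 := by
          intro h
          apply huv
          refine ⟨ρ ⬝ᵥ v, ?_⟩
          have h2 := congrArg (fun M => M *ᵥ v) hRQ
          simp only [← Matrix.mulVec_mulVec, h, Matrix.mulVec_zero, Matrix.sub_mulVec,
            Matrix.one_mulVec, Matrix.vecMulVec_mulVec] at h2
          simpa using (sub_eq_zero.1 h2.symm)
        rw [← ih (Q * (m' * R)) (Q *ᵥ v) hQv]
        symm
        refine Fintype.sum_of_injective (fun l : Fin n → F => l ᵥ* Q) ?_ _ _ ?_ ?_
        · intro a b hab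
          have h2 := congrArg (fun w => w ᵥ* R) hab
          simpa [Matrix.vecMul_vecMul, hQR] using h2
        · intro l hl
          have hlu : l ⬝ᵥ u ≠ 0 := fun h => hl ⟨l ᵥ* R, hl0 l h⟩
          apply wt_unit _ _ _ (det_ne_of_mem m' v l u hX' _ hlu (hvl l))
          intro h1
          have h2 := hvl l
          rw [h1, Matrix.one_mulVec] at h2
          apply huv
          exact ⟨(l ⬝ᵥ u)⁻¹, ((inv_smul_eq_iff₀ hlu).2 h2).symm⟩
        · intro l
          have e : Q * (m' * R) + vecMulVec (Q *ᵥ v) l = Q * (m' * R + vecMulVec v l) := by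
            rw [Matrix.mul_add, Matrix.mul_vecMulVec]
          rw [e, wt_swap, Matrix.add_mul, hmRQ, Matrix.vecMulVec_mul]
    · -- all of `m + v λ` have image in a common hyperplane
      push Not at hX
      obtain ⟨ξ, h1, h2, h0⟩ := hX
      obtain ⟨Q, R, ρ, hQR, hQu, hRQ⟩ := exists_quot ξ h0
      have hLA : Rᵀ * Qᵀ = 1 := by rw [← Matrix.transpose_mul, hQR, Matrix.transpose_one]
      have hAL : Qᵀ * Rᵀ = 1 - vecMulVec ρ ξ := by
        rw [← Matrix.transpose_mul, hRQ, Matrix.transpose_sub, Matrix.transpose_one,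
          Matrix.transpose_vecMulVec]
      have hALm : Qᵀ * (Rᵀ * m) = m := by
        rw [← Matrix.mul_assoc, hAL, Matrix.sub_mul, Matrix.vecMulVec_mul, h1]; simp
      have hALv : Qᵀ *ᵥ (Rᵀ *ᵥ v) = v := by
        rw [Matrix.mulVec_mulVec, hAL, Matrix.sub_mulVec, Matrix.vecMulVec_mulVec, h2]; simp
      have hterm : ∀ lam : Fin (n + 1) → F, wt k (Fintype.card F) (m + vecMulVec v lam) =
          wt k (Fintype.card F) (Rᵀ * m * Qᵀ + vecMulVec (Rᵀ *ᵥ v) (lam ᵥ* Qᵀ)) := by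
        intro lam
        have e : m + vecMulVec v lam = Qᵀ * (Rᵀ * m + vecMulVec (Rᵀ *ᵥ v) lam) := by
          rw [Matrix.mul_add, hALm, Matrix.mul_vecMulVec, hALv]
        rw [e, wt_swap, Matrix.add_mul, Matrix.vecMulVec_mul]
      rw [Finset.sum_congr rfl fun l _ => hterm l]
      have hs := card_sum_surj (G := Fin (n + 1) → F) (H := Fin n → F)
        (AddMonoidHom.mk' (fun l => l ᵥ* Qᵀ) (fun a b => Matrix.add_vecMul _ _ _))
        (fun l => ⟨l ᵥ* Rᵀ, by simp [Matrix.vecMul_vecMul, hLA]⟩)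
        (fun l => wt k (Fintype.card F) (Rᵀ * m * Qᵀ + vecMulVec (Rᵀ *ᵥ v) l))
      have hv' : Rᵀ *ᵥ v ≠ 0 := by
        intro h
        rw [h] at hALv
        simp at hALv
        exact hv hALv.symm
      rw [ih _ _ hv', smul_zero] at hs
      simp only [AddMonoidHom.mk'_apply, nsmul_eq_mul] at hs
      refine (mul_eq_zero.1 hs).resolve_left ?_
      simp only [Fintype.card_pi, Finset.prod_const, Nat.cast_pow]
      exact pow_ne_zero _ hq

theorem key_left (hq : (Fintype.card F : k) ≠ 0) (n : ℕ)
    (m : Matrix (Fin n) (Fin n) F) (lam : Fin n → F) (hl : lam ≠ 0) :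
    ∑ v : Fin n → F, wt k (Fintype.card F) (m + vecMulVec v lam) = 0 := by
  rw [← key_right k hq n mᵀ lam hl]
  refine Finset.sum_congr rfl fun v _ => ?_
  rw [← wt_transpose, Matrix.transpose_add, Matrix.transpose_vecMulVec]

end key

section counting

/-- Natural-number version of the Gaussian binomial. -/
def qbN (q : ℕ) : ℕ → ℕ → ℕ
  | _, 0 => 1
  | 0, _ + 1 => 0
  | a + 1, b + 1 => qbN q a b + q ^ (b + 1) * qbN q a (b + 1)

theorem qbinomEval_eq {k : Type*} [Field k] (q : ℕ) (a b : ℕ) :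
    qbinomEval (q : k) a b = (qbN q a b : k) := by
  induction a generalizing b with
  | zero => cases b <;> simp [qbinomEval, qbN]
  | succ a ih => cases b <;> simp [qbinomEval, qbN, ih]

theorem prod_rec (q : ℚ) (a b : ℕ) :
    ∏ t ∈ Finset.range (b + 1), (q ^ (a + 1) - q ^ t) =
      (q ^ (a + 1) - 1) * q ^ b * ∏ t ∈ Finset.range b, (q ^ a - q ^ t) := by
  rw [Finset.prod_range_succ']
  have : ∀ t ∈ Finset.range b, q ^ (a + 1) - q ^ (t + 1) = q * (q ^ a - q ^ t) := by
    intro t _; ring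
  rw [Finset.prod_congr rfl this, Finset.prod_mul_distrib]
  simp; ring

theorem qbN_prod (q a b : ℕ) :
    (qbN q a b : ℚ) * ∏ t ∈ Finset.range b, ((q : ℚ) ^ b - (q : ℚ) ^ t) =
      ∏ t ∈ Finset.range b, ((q : ℚ) ^ a - (q : ℚ) ^ t) := by
  induction a generalizing b with
  | zero =>
    cases b with
    | zero => simp [qbN]
    | succ b =>
      rw [Finset.prod_range_succ' (fun t => ((q : ℚ) ^ 0 - (q : ℚ) ^ t))]
      simp [qbN]
  | succ a ih =>
    cases b with
    | zero => simp [qbN]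
    | succ b =>
      have h1 := ih b
      have h2 := ih (b + 1)
      rw [prod_rec] at h2 ⊢
      rw [prod_rec, qbN]
      rw [Finset.prod_range_succ] at h2
      push_cast
      linear_combination ((q : ℚ) ^ (b + 1) - 1) * (q : ℚ) ^ b * h1 + (q : ℚ) ^ (b + 1) * h2

theorem prod_ne_zero' (q b : ℕ) (hq : 2 ≤ q) :
    ∏ t ∈ Finset.range b, ((q : ℚ) ^ b - (q : ℚ) ^ t) ≠ 0 := by
  rw [Finset.prod_ne_zero_iff]
  intro t ht
  rw [sub_ne_zero]
  intro h
  have h' : q ^ b = q ^ t := by exact_mod_cast h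
  have := Nat.pow_right_injective hq h'
  simp at ht
  omega

theorem qbN_pascal (q a b : ℕ) (hq : 2 ≤ q) (hb : b ≤ a) :
    qbN q (a + 1) (b + 1) = qbN q a (b + 1) + q ^ (a - b) * qbN q a b := by
  have h : (qbN q (a + 1) (b + 1) : ℚ) = qbN q a (b + 1) + (q : ℚ) ^ (a - b) * qbN q a b := by
    apply mul_right_cancel₀ (prod_ne_zero' q (b + 1) hq)
    rw [qbN_prod, add_mul, qbN_prod, prod_rec, prod_rec, Finset.prod_range_succ]
    have h1 := qbN_prod q a b
    obtain ⟨c, rfl⟩ := Nat.exists_eq_add_of_le hb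
    rw [Nat.add_sub_cancel_left]
    rw [pow_succ, pow_add] at *
    linear_combination (-(q : ℚ) ^ c * ((q : ℚ) ^ (b + 1) - 1) * (q : ℚ) ^ b) * h1
  exact_mod_cast h

variable {F : Type*} [Field F] [Fintype F]

theorem card_subspaces {V : Type*} [AddCommGroup V] [Module F V] [Finite V]
    (i : ℕ) :
    Nat.card {P : Submodule F V // Module.finrank F P = i} =
      qbN (Fintype.card F) (Module.finrank F V) i := by
  classical
  have : Fintype V := Fintype.ofFinite V
  by_cases hi : i ≤ Module.finrank F V
  swap
  · have h1 := qbN_prod (Fintype.card F) (Module.finrank F V) i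
    have h0 : ∏ t ∈ Finset.range i, ((Fintype.card F : ℚ) ^ (Module.finrank F V) -
        (Fintype.card F : ℚ) ^ t) = 0 :=
      Finset.prod_eq_zero (i := Module.finrank F V) (by simp; omega) (sub_self _)
    rw [h0] at h1
    have h2 := (mul_eq_zero.1 h1).resolve_right
      (prod_ne_zero' _ i (Fintype.one_lt_card (α := F)))
    have h3 : qbN (Fintype.card F) (Module.finrank F V) i = 0 := by exact_mod_cast h2
    rw [h3]
    have : IsEmpty {P : Submodule F V // Module.finrank F P = i} := by
      constructor
      rintro ⟨P, hP⟩
      have := Submodule.finrank_le P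
      omega
    exact Nat.card_of_isEmpty
  have haux : ∀ (P P' : Submodule F V) (hP : Module.finrank F P = i)
      (hP' : Module.finrank F P' = i) (s : Fin i → P) (s' : Fin i → P')
      (hs : LinearIndependent F s) (hs' : LinearIndependent F s'), P = P' →
      (∀ j, (s j : V) = s' j) →
      (⟨⟨P, hP⟩, ⟨s, hs⟩⟩ : Σ P : {P : Submodule F V // Module.finrank F P = i},
        {s : Fin i → P.1 // LinearIndependent F s}) = ⟨⟨P', hP'⟩, ⟨s', hs'⟩⟩ := by
    rintro P P' hP hP' s s' hs hs' rfl h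
    have : s = s' := funext fun j => Subtype.ext (h j)
    subst this
    rfl
  have hE : {s : Fin i → V // LinearIndependent F s} ≃
      Σ P : {P : Submodule F V // Module.finrank F P = i},
        {s : Fin i → P.1 // LinearIndependent F s} :=
    { toFun := fun s => ⟨⟨Submodule.span F (Set.range s.1), by
          rw [finrank_span_eq_card s.2]; simp⟩,
          ⟨fun j => ⟨s.1 j, Submodule.subset_span ⟨j, rfl⟩⟩, by
            have := s.2
            rw [← LinearMap.linearIndependent_iff (Submodule.subtype _)
              (Submodule.ker_subtype _)]
            exact this⟩⟩
      invFun := fun x => ⟨fun j => (x.2.1 j : V), x.2.2.map' (Submodule.subtype _)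
              (Submodule.ker_subtype _)⟩
      left_inv := fun s => rfl
      right_inv := by
        rintro ⟨⟨P, hP⟩, ⟨s, hs⟩⟩
        have hs' : LinearIndependent F (fun j => (s j : V)) :=
          hs.map' (Submodule.subtype _) (Submodule.ker_subtype _)
        have e : Submodule.span F (Set.range fun j => (s j : V)) = P := by
          apply Submodule.eq_of_le_of_finrank_eq
          · rw [Submodule.span_le]
            rintro _ ⟨j, rfl⟩
            exact (s j).2
          · rw [finrank_span_eq_card hs', hP]; simp
        exact haux _ _ _ _ _ _ _ _ e (fun j => rfl) }
  have hc := Nat.card_congr hE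
  rw [card_linearIndependent hi, Nat.card_sigma] at hc
  have h2 : ∀ P : {P : Submodule F V // Module.finrank F P = i},
      Nat.card {s : Fin i → P.1 // LinearIndependent F s} =
        ∏ t : Fin i, (Fintype.card F ^ i - Fintype.card F ^ t.1) := by
    intro P
    rw [card_linearIndependent P.2.ge, P.2]
  rw [Finset.sum_congr rfl fun P _ => h2 P, Finset.sum_const, Finset.card_univ,
    ← Nat.card_eq_fintype_card (α := {P : Submodule F V // Module.finrank F P = i}),
    smul_eq_mul] at hc
  have hcast : ∀ N : ℕ, i ≤ N → ((∏ t : Fin i, (Fintype.card F ^ N - Fintype.card F ^ t.1) : ℕ) : ℚ)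
      = ∏ t ∈ Finset.range i, ((Fintype.card F : ℚ) ^ N - (Fintype.card F : ℚ) ^ t) := by
    intro N hN
    rw [Nat.cast_prod, ← Fin.prod_univ_eq_prod_range
      (fun t => ((Fintype.card F : ℚ) ^ N - (Fintype.card F : ℚ) ^ t))]
    refine Finset.prod_congr rfl fun t _ => ?_
    rw [Nat.cast_sub]
    · simp
    · exact Nat.pow_le_pow_right Fintype.card_pos (by omega)
  have h3 := congrArg (fun x : ℕ => (x : ℚ)) hc
  rw [Nat.cast_mul, hcast _ hi, hcast _ le_rfl, ← qbN_prod] at h3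
  have h4 := mul_right_cancel₀ (prod_ne_zero' _ i (Fintype.one_lt_card (α := F))) h3
  exact_mod_cast h4.symm

theorem card_subspaces_ge {V : Type*} [AddCommGroup V] [Module F V] [Finite V]
    (I : Submodule F V) (r : ℕ) (hr : Module.finrank F I ≤ r) :
    Nat.card {P : Submodule F V // Module.finrank F P = r ∧ I ≤ P} =
      qbN (Fintype.card F) (Module.finrank F V - Module.finrank F I)
        (r - Module.finrank F I) := by
  have h0 := Submodule.finrank_quotient_add_finrank I
  have h1 : Module.finrank F V - Module.finrank F I = Module.finrank F (V ⧸ I) := by omega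
  have : Finite (V ⧸ I) := Finite.of_surjective _ I.mkQ_surjective
  rw [h1, ← card_subspaces]
  refine Nat.card_congr ?_
  have hfr : ∀ P : Submodule F (V ⧸ I), Module.finrank F (P.comap I.mkQ) =
      Module.finrank F P + Module.finrank F I := by
    intro P
    have h := LinearMap.finrank_range_add_finrank_ker (I.mkQ.domRestrict (P.comap I.mkQ))
    rw [← h]
    have e1 : LinearMap.range (I.mkQ.domRestrict (P.comap I.mkQ)) = P := by
      rw [LinearMap.range_domRestrict, Submodule.map_comap_eq_of_surjective I.mkQ_surjective]
    have e2 : LinearMap.ker (I.mkQ.domRestrict (P.comap I.mkQ)) =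
        I.comap (P.comap I.mkQ).subtype := by
      ext x
      simp
    rw [e1, e2]
    congr 1
    have hle : I ≤ P.comap I.mkQ := by
      intro x hx
      simp [(Submodule.Quotient.mk_eq_zero I).2 hx]
    exact (Submodule.comapSubtypeEquivOfLe hle).finrank_eq
  exact {
    toFun := fun P => ⟨P.1.map I.mkQ, by
      have h := hfr (P.1.map I.mkQ)
      rw [Submodule.comap_map_eq, Submodule.ker_mkQ, sup_eq_left.2 P.2.2, P.2.1] at h
      omega⟩
    invFun := fun P => ⟨P.1.comap I.mkQ, by rw [hfr, P.2]; omega, by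
      intro x hx
      simp [(Submodule.Quotient.mk_eq_zero I).2 hx]⟩
    left_inv := by
      rintro ⟨P, h1, h2⟩
      apply Subtype.ext
      simp only
      rw [Submodule.comap_map_eq, Submodule.ker_mkQ, sup_eq_left.2 h2]
    right_inv := by
      rintro ⟨P, h1⟩
      apply Subtype.ext
      simp only
      rw [Submodule.map_comap_eq_of_surjective I.mkQ_surjective] }

end counting

section main

variable {F : Type*} [Field F]

theorem exists_param {n r : ℕ} (P : Submodule F (Fin n → F)) (hP : Module.finrank F P = r) :
    ∃ (A : Matrix (Fin n) (Fin r) F) (L : Matrix (Fin r) (Fin n) F),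
      L * A = 1 ∧ ∀ w, w ∈ P ↔ A *ᵥ (L *ᵥ w) = w := by
  let e : P ≃ₗ[F] (Fin r → F) := LinearEquiv.ofFinrankEq _ _ (by simp [hP])
  let f : (Fin r → F) →ₗ[F] (Fin n → F) := P.subtype ∘ₗ e.symm.toLinearMap
  have hf : LinearMap.ker f = ⊥ := by
    rw [LinearMap.ker_eq_bot]
    exact P.injective_subtype.comp e.symm.injective
  obtain ⟨g, hg⟩ := f.exists_leftInverse_of_injective hf
  refine ⟨LinearMap.toMatrix' f, LinearMap.toMatrix' g, ?_, ?_⟩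
  · rw [← LinearMap.toMatrix'_comp, hg, LinearMap.toMatrix'_id]
  · intro w
    rw [LinearMap.toMatrix'_mulVec, LinearMap.toMatrix'_mulVec]
    constructor
    · intro hw
      have h1 : f (e ⟨w, hw⟩) = w := by simp [f]
      have h2 : g (f (e ⟨w, hw⟩)) = e ⟨w, hw⟩ := LinearMap.congr_fun hg _
      rw [h1] at h2
      rw [h2, h1]
    · intro h
      rw [← h]
      simp [f]

theorem exists_ker_of_rank_lt {n s : ℕ} (M : Matrix (Fin n) (Fin s) F) (h : M.rank < s) :
    ∃ v ≠ 0, M *ᵥ v = 0 := by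
  have h1 := LinearMap.finrank_range_add_finrank_ker M.mulVecLin
  rw [Module.finrank_fin_fun] at h1
  have h2 : Module.finrank F (LinearMap.range M.mulVecLin) = M.rank := rfl
  have h3 : LinearMap.ker M.mulVecLin ≠ ⊥ := by
    intro h4
    rw [h4, finrank_bot] at h1
    omega
  obtain ⟨v, hv, hv0⟩ := Submodule.exists_mem_ne_zero_of_ne_bot h3
  exact ⟨v, hv0, by simpa using hv⟩

theorem rank_lt_of_det {s : ℕ} (M : Matrix (Fin s) (Fin s) F) (h : M.det = 0) : M.rank < s := by
  obtain ⟨v, hv, h0⟩ := Matrix.exists_mulVec_eq_zero_iff.2 h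
  have h1 := LinearMap.finrank_range_add_finrank_ker M.mulVecLin
  rw [Module.finrank_fin_fun] at h1
  have h2 : Module.finrank F (LinearMap.range M.mulVecLin) = M.rank := rfl
  have h3 : 0 < Module.finrank F (LinearMap.ker M.mulVecLin) := by
    rw [Module.finrank_pos_iff_exists_ne_zero]
    exact ⟨⟨v, by simpa using h0⟩, fun h => hv (congrArg Subtype.val h)⟩
  omega

theorem rank_le_zero_iff' {n : ℕ} (M : Matrix (Fin n) (Fin n) F) : M.rank ≤ 0 ↔ M = 0 := by
  constructor
  · intro h
    have h2 : Module.finrank F (LinearMap.range M.mulVecLin) = 0 := Nat.le_zero.1 h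
    rw [Submodule.finrank_eq_zero, LinearMap.range_eq_bot] at h2
    ext i j
    have := congrFun (LinearMap.congr_fun h2 (Pi.single j 1)) i
    simpa using this
  · rintro rfl
    simp

theorem exists_row {n : ℕ} (P X : Submodule F (Fin n → F)) (h : ¬ P ≤ X) :
    ∃ lam : Fin n → F, (∀ w ∈ X, lam ⬝ᵥ w = 0) ∧ ∃ w ∈ P, lam ⬝ᵥ w ≠ 0 := by
  obtain ⟨w, hw, hwX⟩ := SetLike.not_le_iff_exists.1 h
  obtain ⟨f, hf, hX⟩ := Submodule.exists_le_ker_of_notMem hwX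
  refine ⟨(dotProductEquiv F (Fin n)).symm f, ?_, w, hw, ?_⟩
  · intro y hy
    have := hX hy
    rw [LinearMap.mem_ker] at this
    rw [← this]
    exact LinearMap.congr_fun ((dotProductEquiv F (Fin n)).apply_symm_apply f) y
  · intro h0
    apply hf
    rw [← h0]
    exact (LinearMap.congr_fun ((dotProductEquiv F (Fin n)).apply_symm_apply f) w).symm

variable [Fintype F] (k : Type*) [Field k]
variable {E : Type*} [AddCommGroup E] [Module k E]

theorem term_zero (hq : (Fintype.card F : k) ≠ 0) {n r : ℕ} (A : Matrix (Fin n) (Fin r) F)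
    (x : Matrix (Fin n) (Fin n) F) (lam : Fin n → F) (hx : lam ᵥ* x = 0) (hA : lam ᵥ* A ≠ 0)
    (g : Matrix (Fin n) (Fin n) F → E) :
    ∑ B : Matrix (Fin r) (Fin n) F, wt k (Fintype.card F) (B * A) • g (A * B * x) = 0 := by
  have hv0 : ∀ u : Fin r → F, vecMulVec u (0 : Fin n → F) = 0 := by
    intro u
    ext i j
    simp [vecMulVec_apply]
  have h1 : ∀ u : Fin r → F,
      ∑ B : Matrix (Fin r) (Fin n) F, wt k (Fintype.card F) (B * A) • g (A * B * x) =
      ∑ B : Matrix (Fin r) (Fin n) F,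
        wt k (Fintype.card F) (B * A + vecMulVec u (lam ᵥ* A)) • g (A * B * x) := by
    intro u
    rw [← Equiv.sum_comp (Equiv.addRight (vecMulVec u lam))]
    refine Finset.sum_congr rfl fun B _ => ?_
    simp only [Equiv.coe_addRight]
    rw [Matrix.add_mul, Matrix.vecMulVec_mul, Matrix.mul_assoc A, Matrix.add_mul,
      Matrix.vecMulVec_mul, hx, hv0, add_zero, Matrix.mul_assoc A]
  have h2 : ((Fintype.card (Fin r → F) : ℕ) : k) •
      ∑ B : Matrix (Fin r) (Fin n) F, wt k (Fintype.card F) (B * A) • g (A * B * x) = 0 := by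
    calc _ = ∑ u : Fin r → F, ∑ B : Matrix (Fin r) (Fin n) F,
          wt k (Fintype.card F) (B * A) • g (A * B * x) := by
          rw [Finset.sum_const, Finset.card_univ, Nat.cast_smul_eq_nsmul]
      _ = ∑ u : Fin r → F, ∑ B : Matrix (Fin r) (Fin n) F,
          wt k (Fintype.card F) (B * A + vecMulVec u (lam ᵥ* A)) • g (A * B * x) :=
          Finset.sum_congr rfl fun u _ => h1 u
      _ = 0 := by
          rw [Finset.sum_comm]
          refine Finset.sum_eq_zero fun B _ => ?_
          rw [← Finset.sum_smul, key_left k hq r _ _ hA, zero_smul]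
  refine (smul_eq_zero.1 h2).resolve_left ?_
  simp only [Fintype.card_pi, Finset.prod_const, Nat.cast_pow]
  exact pow_ne_zero _ hq

theorem term_zero' (hq : (Fintype.card F : k) ≠ 0) {n s : ℕ} (M : Matrix (Fin n) (Fin s) F)
    (hM : M.rank < s) (C : Matrix (Fin s) (Fin n) F)
    (g : Matrix (Fin n) (Fin n) F → E) :
    ∑ φ : Matrix (Fin s) (Fin s) F, wt k (Fintype.card F) φ • g (M * φ * C) = 0 := by
  obtain ⟨v, hv, h0⟩ := exists_ker_of_rank_lt M hM
  have h1 : ∀ u : Fin s → F,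
      ∑ φ : Matrix (Fin s) (Fin s) F, wt k (Fintype.card F) φ • g (M * φ * C) =
      ∑ φ : Matrix (Fin s) (Fin s) F,
        wt k (Fintype.card F) (φ + vecMulVec v u) • g (M * φ * C) := by
    intro u
    rw [← Equiv.sum_comp (Equiv.addRight (vecMulVec v u))]
    refine Finset.sum_congr rfl fun B _ => ?_
    simp only [Equiv.coe_addRight]
    rw [Matrix.mul_add, Matrix.mul_vecMulVec, h0, Matrix.zero_vecMulVec, add_zero]
  have h2 : ((Fintype.card (Fin s → F) : ℕ) : k) •
      ∑ φ : Matrix (Fin s) (Fin s) F, wt k (Fintype.card F) φ • g (M * φ * C) = 0 := by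
    calc _ = ∑ u : Fin s → F, ∑ φ : Matrix (Fin s) (Fin s) F,
          wt k (Fintype.card F) φ • g (M * φ * C) := by
          rw [Finset.sum_const, Finset.card_univ, Nat.cast_smul_eq_nsmul]
      _ = ∑ u : Fin s → F, ∑ φ : Matrix (Fin s) (Fin s) F,
          wt k (Fintype.card F) (φ + vecMulVec v u) • g (M * φ * C) :=
          Finset.sum_congr rfl fun u _ => h1 u
      _ = 0 := by
          rw [Finset.sum_comm]
          refine Finset.sum_eq_zero fun B _ => ?_
          rw [← Finset.sum_smul, key_right k hq s _ _ hv, zero_smul]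
  refine (smul_eq_zero.1 h2).resolve_left ?_
  simp only [Fintype.card_pi, Finset.prod_const, Nat.cast_pow]
  exact pow_ne_zero _ hq

/-- Coefficient of `[m]` in the unnormalized `η_r`. -/
noncomputable def co {n : ℕ} (r : ℕ) (m : Matrix (Fin n) (Fin n) F) : k :=
  if m.rank ≤ r then
    wt k (Fintype.card F) m * (qbN (Fintype.card F) (n - 1 - m.rank) (r - m.rank) : k) else 0

/-- Coefficient of `[m]` in the sum over `r`-dimensional subspaces `P` of maps into `P`. -/
noncomputable def cT {n : ℕ} (r : ℕ) (m : Matrix (Fin n) (Fin n) F) : k :=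
  wt k (Fintype.card F) m * (Nat.card {P : Submodule F (Fin n → F) //
    Module.finrank F P = r ∧ LinearMap.range m.mulVecLin ≤ P} : k)

theorem co_succ {n r : ℕ} (hr : r + 2 ≤ n) (m : Matrix (Fin n) (Fin n) F) :
    co k (r + 1) m = cT k (r + 1) m - (Fintype.card F : k) ^ (n - (r + 1)) * co k r m := by
  have hfr : Module.finrank F (LinearMap.range m.mulVecLin) = m.rank := rfl
  unfold co cT
  by_cases h : m.rank ≤ r + 1
  · rw [if_pos h, card_subspaces_ge _ _ (by rw [hfr]; exact h), hfr, Module.finrank_fin_fun]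
    by_cases h' : m.rank ≤ r
    · rw [if_pos h']
      have e1 : n - m.rank = (n - 1 - m.rank) + 1 := by omega
      have e2 : r + 1 - m.rank = (r - m.rank) + 1 := by omega
      have e3 : n - (r + 1) = (n - 1 - m.rank) - (r - m.rank) := by omega
      rw [e1, e2, qbN_pascal _ _ _ (Fintype.one_lt_card (α := F)) (by omega), ← e3]
      push_cast
      ring
    · rw [if_neg h']
      have e2 : r + 1 - m.rank = 0 := by omega
      rw [e2]
      simp [qbN]
  · rw [if_neg h, if_neg (by omega)]
    have : IsEmpty {P : Submodule F (Fin n → F) //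
        Module.finrank F P = r + 1 ∧ LinearMap.range m.mulVecLin ≤ P} := by
      constructor
      rintro ⟨P, h1, h2⟩
      have := Submodule.finrank_mono h2
      rw [hfr, h1] at this
      exact h this
    rw [Nat.card_of_isEmpty]
    simp

open scoped Classical in
theorem cT_sum {n r : ℕ} (g : Matrix (Fin n) (Fin n) F → E) :
    ∃ (A : {P : Submodule F (Fin n → F) // Module.finrank F P = r} → Matrix (Fin n) (Fin r) F)
      (L : {P : Submodule F (Fin n → F) // Module.finrank F P = r} → Matrix (Fin r) (Fin n) F),
      (∀ P, L P * A P = 1 ∧ ∀ w, w ∈ P.1 ↔ A P *ᵥ (L P *ᵥ w) = w) ∧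
      ∑ m, cT k r m • g m = ∑ P : {P : Submodule F (Fin n → F) // Module.finrank F P = r},
        ∑ B : Matrix (Fin r) (Fin n) F, wt k (Fintype.card F) (B * A P) • g (A P * B) := by
  choose A L h1 h2 using
    fun P : {P : Submodule F (Fin n → F) // Module.finrank F P = r} => exists_param P.1 P.2
  refine ⟨A, L, fun P => ⟨h1 P, h2 P⟩, ?_⟩
  have e1 : ∀ m : Matrix (Fin n) (Fin n) F, cT k r m • g m =
      ∑ P : {P : Submodule F (Fin n → F) // Module.finrank F P = r},
        if LinearMap.range m.mulVecLin ≤ P.1 then wt k (Fintype.card F) m • g m else 0 := by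
    intro m
    unfold cT
    rw [← Finset.sum_filter, Finset.sum_const, ← Nat.cast_smul_eq_nsmul k, smul_smul, mul_comm]
    congr 3
    rw [← Fintype.card_subtype, ← Nat.card_eq_fintype_card]
    exact Nat.card_congr (Equiv.subtypeSubtypeEquivSubtypeInter _ _).symm
  rw [Finset.sum_congr rfl fun m _ => e1 m, Finset.sum_comm]
  refine Finset.sum_congr rfl fun P _ => ?_
  symm
  refine Fintype.sum_of_injective (fun B : Matrix (Fin r) (Fin n) F => A P * B) ?_ _ _ ?_ ?_
  · intro B B' h
    have := congrArg (fun M => L P * M) h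
    simpa [← Matrix.mul_assoc, h1 P] using this
  · intro m hm
    apply if_neg
    intro h
    apply hm
    refine ⟨L P * m, ?_⟩
    simp only
    apply Matrix.ext_of_mulVec_single
    intro i
    rw [← Matrix.mulVec_mulVec, ← Matrix.mulVec_mulVec]
    exact (h2 P _).1 (h ⟨_, rfl⟩)
  · intro B
    rw [if_pos, wt_swap]
    rintro _ ⟨w, rfl⟩
    rw [h2 P, Matrix.mulVecLin_apply, Matrix.mulVec_mulVec, Matrix.mulVec_mulVec,
      ← Matrix.mul_assoc, Matrix.mul_assoc (A P), h1 P, Matrix.mul_one]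

theorem row_kill {n r : ℕ} (P : Submodule F (Fin n → F)) (A : Matrix (Fin n) (Fin r) F)
    (L : Matrix (Fin r) (Fin n) F) (hP : ∀ w, w ∈ P ↔ A *ᵥ (L *ᵥ w) = w)
    (x : Matrix (Fin n) (Fin n) F) (h : ¬ P ≤ LinearMap.range x.mulVecLin) :
    ∃ lam : Fin n → F, lam ᵥ* x = 0 ∧ lam ᵥ* A ≠ 0 := by
  obtain ⟨lam, h1, w, hw, h2⟩ := exists_row _ _ h
  refine ⟨lam, ?_, ?_⟩
  · ext j
    have := h1 (x *ᵥ Pi.single j 1) ⟨_, rfl⟩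
    rw [Matrix.dotProduct_mulVec] at this
    simpa using this
  · intro h0
    apply h2
    rw [← (hP w).1 hw, Matrix.dotProduct_mulVec, h0]
    simp

/-- The normalizing constant. -/
noncomputable def cst (F : Type*) [Fintype F] (k : Type*) [Field k] (n r : ℕ) : k :=
  ((Fintype.card F : k) ^ ((n - 1) * r))⁻¹ * muq k (Fintype.card F) r

theorem cst_succ (hq : (Fintype.card F : k) ≠ 0) {n r : ℕ} (hr : r + 2 ≤ n) :
    - (cst F k n (r + 1) * (Fintype.card F : k) ^ (n - (r + 1))) = cst F k n r := by
  unfold cst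
  rw [muq_succ, Nat.mul_succ, pow_add]
  have e : n - 1 = r + (n - (r + 1)) := by omega
  have h1 := pow_ne_zero ((n - 1) * r) hq
  have h2 : (Fintype.card F : k) ^ (n - 1) = (Fintype.card F : k) ^ r *
      (Fintype.card F : k) ^ (n - (r + 1)) := by rw [← pow_add, ← e]
  have h3 := pow_ne_zero r hq
  have h4 := pow_ne_zero (n - (r + 1)) hq
  rw [h2]
  field_simp

theorem muq_sq (q r : ℕ) : muq k q (r + 1) * muq k q (r + 1) = (q : k) ^ ((r + 1) * r) := by
  unfold muq
  have : (r + 1).choose 2 + (r + 1).choose 2 = (r + 1) * r := by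
    have := Nat.choose_two_right (r + 1)
    have h2 := Nat.even_mul_succ_self r
    rw [Nat.add_sub_cancel] at this
    rw [this]
    obtain ⟨c, hc⟩ := h2
    rw [mul_comm (r + 1) r]
    omega
  rw [mul_mul_mul_comm, ← pow_add, ← pow_add, this]
  rw [← two_mul, pow_mul]
  simp

theorem muq_ne (q r : ℕ) (hq : (q : k) ≠ 0) : muq k q r ≠ 0 := by
  unfold muq
  exact mul_ne_zero (pow_ne_zero _ (by simp)) (pow_ne_zero _ hq)

theorem left_unit (hq : (Fintype.card F : k) ≠ 0) {n : ℕ} (r : ℕ) (hr : r + 1 ≤ n) :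
    ∀ (g : Matrix (Fin n) (Fin n) F → E) (x : Matrix (Fin n) (Fin n) F), x.rank ≤ r →
      ∑ m, (cst F k n r * co k r m) • g (m * x) = g x := by
  classical
  induction r with
  | zero =>
    intro g x hx
    rw [rank_le_zero_iff'] at hx
    subst hx
    rw [Finset.sum_eq_single 0]
    · have h1 : wt k (Fintype.card F) (0 : Matrix (Fin n) (Fin n) F) = 1 := by
        unfold wt
        rw [if_pos ((semi_iff _).2 ⟨1, by simp⟩)]
        have : srk (0 : Matrix (Fin n) (Fin n) F) = 0 := by
          unfold srk
          rw [zero_pow (by omega), Matrix.rank_zero]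
        rw [this]
        simp [muq]
      simp [cst, co, muq, h1, qbN]
    · intro m _ hm
      rw [co, if_neg (fun h => hm ((rank_le_zero_iff' m).1 h))]
      simp
    · simp
  | succ r ih =>
    intro g x hx
    have ih := ih (by omega)
    have e0 : ∀ m : Matrix (Fin n) (Fin n) F, cst F k n (r + 1) * co k (r + 1) m =
        cst F k n r * co k r m + cst F k n (r + 1) * cT k (r + 1) m := by
      intro m
      rw [co_succ k hr, ← cst_succ k hq hr]
      ring
    simp only [e0, add_smul]
    rw [Finset.sum_add_distrib]
    simp only [mul_smul (cst F k n (r + 1))]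
    rw [← Finset.smul_sum]
    obtain ⟨A, L, hAL, hs⟩ := cT_sum k (r := r + 1) (fun m => g (m * x))
    rw [hs]
    have hfx : Module.finrank F (LinearMap.range x.mulVecLin) = x.rank := rfl
    have hz : ∀ P : {P : Submodule F (Fin n → F) // Module.finrank F P = r + 1},
        P.1 ≠ LinearMap.range x.mulVecLin →
        ∑ B : Matrix (Fin (r + 1)) (Fin n) F, wt k (Fintype.card F) (B * A P) • g (A P * B * x) = 0 := by
      intro P hP
      have hnot : ¬ P.1 ≤ LinearMap.range x.mulVecLin := by
        intro h
        apply hP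
        apply Submodule.eq_of_le_of_finrank_le h
        rw [hfx, P.2]
        exact hx
      obtain ⟨lam, h1, h2⟩ := row_kill P.1 (A P) (L P) (hAL P).2 x hnot
      exact term_zero k hq (A P) x lam h1 h2 g
    by_cases hxr : x.rank ≤ r
    · rw [ih g x hxr, Finset.sum_eq_zero, smul_zero, add_zero]
      intro P _
      apply hz
      intro h
      have h2 := P.2
      rw [h, hfx] at h2
      omega
    · have hxr' : x.rank = r + 1 := by omega
      rw [Finset.sum_eq_single ⟨LinearMap.range x.mulVecLin, hfx.trans hxr'⟩
        (fun P _ hP => hz P (fun h => hP (Subtype.ext h))) (by simp)]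
      obtain ⟨hLA, hPm⟩ := hAL ⟨LinearMap.range x.mulVecLin, hfx.trans hxr'⟩
      generalize A ⟨LinearMap.range x.mulVecLin, hfx.trans hxr'⟩ = A at *
      generalize L ⟨LinearMap.range x.mulVecLin, hfx.trans hxr'⟩ = L at *
      have hxC : A * (L * x) = x := by
        apply Matrix.ext_of_mulVec_single
        intro i
        rw [← Matrix.mulVec_mulVec, ← Matrix.mulVec_mulVec]
        exact (hPm _).1 ⟨_, rfl⟩
      set C := L * x with hC
      set Y := ∑ φ : Matrix (Fin (r + 1)) (Fin (r + 1)) F,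
        wt k (Fintype.card F) φ • g (A * φ * C) with hY
      set T := ∑ B : Matrix (Fin (r + 1)) (Fin n) F, wt k (Fintype.card F) (B * A) • g (A * B * x) with hT
      set Z := ∑ m, (cst F k n r * co k r m) • g (m * x) with hZ
      -- relation between `T` and `Y`
      have hTY : ((Fintype.card F : k) ^ ((r + 1) * (r + 1))) • T =
          ((Fintype.card F : k) ^ ((r + 1) * n)) • Y := by
        have hs := card_sum_surj (G := Matrix (Fin (r + 1)) (Fin n) F)
          (H := Matrix (Fin (r + 1)) (Fin (r + 1)) F)
          (AddMonoidHom.mk' (fun B => B * A) (fun a b => Matrix.add_mul _ _ _))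
          (fun φ => ⟨φ * L, by simp [Matrix.mul_assoc, hLA]⟩)
          (fun φ => wt k (Fintype.card F) φ • g (A * φ * C))
        simp only [AddMonoidHom.mk'_apply] at hs
        have hT' : T = ∑ B : Matrix (Fin (r + 1)) (Fin n) F,
            wt k (Fintype.card F) (B * A) • g (A * (B * A) * C) := by
          rw [hT]
          refine Finset.sum_congr rfl fun B _ => ?_
          rw [← Matrix.mul_assoc A B A, Matrix.mul_assoc (A * B) A C, hxC]
        rw [← hT', ← Nat.cast_smul_eq_nsmul k, ← Nat.cast_smul_eq_nsmul k] at hs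
        have c1 : ∀ a b : ℕ, Fintype.card (Matrix (Fin a) (Fin b) F) = Fintype.card F ^ (a * b) := by
          intro a b
          rw [← Nat.card_eq_fintype_card, ← Nat.card_eq_fintype_card]
          simp [Matrix, Nat.card_fun, ← pow_mul, mul_comm]
        rw [c1, c1] at hs
        push_cast at hs
        exact hs
      -- relation between `Z` and `Y`
      have hZY : muq k (Fintype.card F) (r + 1) • Z =
          muq k (Fintype.card F) (r + 1) • g x - Y := by
        have hφ : ∀ φ : Matrix (Fin (r + 1)) (Fin (r + 1)) F,
            wt k (Fintype.card F) φ • ∑ m, (cst F k n r * co k r m) • g (m * (A * φ * C)) =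
            wt k (Fintype.card F) φ • g (A * φ * C) +
            if φ = 1 then muq k (Fintype.card F) (r + 1) • (Z - g x) else 0 := by
          intro φ
          by_cases h1 : φ = 1
          · subst h1
            rw [if_pos rfl, Matrix.mul_one, hxC, wt_one, ← hZ, smul_sub]
            abel
          · rw [if_neg h1, add_zero]
            by_cases hd : φ.det = 0
            · rw [ih]
              have := rank_lt_of_det φ hd
              have h2 : (A * φ * C).rank ≤ φ.rank :=
                (Matrix.rank_mul_le_left _ _).trans (Matrix.rank_mul_le_right _ _)
              omega
            · rw [wt_unit _ _ _ hd h1, zero_smul, zero_smul]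
        have h0 : ∑ φ : Matrix (Fin (r + 1)) (Fin (r + 1)) F,
            wt k (Fintype.card F) φ • ∑ m, (cst F k n r * co k r m) • g (m * (A * φ * C)) = 0 := by
          simp only [Finset.smul_sum]
          rw [Finset.sum_comm]
          refine Finset.sum_eq_zero fun m _ => ?_
          by_cases hm : m.rank ≤ r
          · have hMA : (m * A).rank < r + 1 :=
              lt_of_le_of_lt (Matrix.rank_mul_le_left _ _) (Nat.lt_succ_of_le hm)
            have h3 := term_zero' k hq (m * A) hMA C g
            have h4 := congrArg (fun e => (cst F k n r * co k r m) • e) h3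
            simp only [Finset.smul_sum, smul_zero] at h4
            rw [← h4]
            refine Finset.sum_congr rfl fun φ _ => ?_
            rw [smul_comm, Matrix.mul_assoc m A φ, Matrix.mul_assoc m (A * φ) C]
          · have : co k r m = 0 := by rw [co, if_neg hm]
            simp [this]
        rw [Finset.sum_congr rfl fun φ _ => hφ φ, Finset.sum_add_distrib, ← hY,
          Finset.sum_ite_eq', if_pos (Finset.mem_univ _), smul_sub] at h0
        rw [eq_sub_iff_add_eq]
        rw [← sub_eq_zero, ← h0]
        abel
      -- conclusion
      have hT2 : muq k (Fintype.card F) (r + 1) • (cst F k n (r + 1) • T) = Y := by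
        have hne : ((Fintype.card F : k) ^ (r + 1)) ≠ 0 := pow_ne_zero _ hq
        have hne2 : ((Fintype.card F : k) ^ ((n - 1) * (r + 1))) ≠ 0 := pow_ne_zero _ hq
        have e1 : (Fintype.card F : k) ^ ((r + 1) * (r + 1)) =
            (Fintype.card F : k) ^ ((r + 1) * r) * (Fintype.card F : k) ^ (r + 1) := by
          rw [← pow_add]; congr 1
        have e2 : (Fintype.card F : k) ^ ((r + 1) * n) =
            (Fintype.card F : k) ^ ((n - 1) * (r + 1)) * (Fintype.card F : k) ^ (r + 1) := by
          rw [← pow_add]; congr 1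
          obtain ⟨d, rfl⟩ : ∃ d, n = d + 1 := ⟨n - 1, by omega⟩
          rw [Nat.add_sub_cancel]; ring
        rw [e1, e2] at hTY
        rw [smul_smul, cst, mul_left_comm, muq_sq]
        rw [← (smul_right_injective E (mul_ne_zero hne2 hne)).eq_iff]
        rw [← hTY, smul_smul]
        congr 1
        field_simp
      apply smul_right_injective E (muq_ne k (Fintype.card F) (r + 1) hq)
      simp only
      rw [smul_add, hZY, hT2]
      abel

theorem co_transpose {n r : ℕ} (m : Matrix (Fin n) (Fin n) F) : co k r mᵀ = co k r m := by
  unfold co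
  rw [Matrix.rank_transpose, wt_transpose]

theorem etaR_eq (n r : ℕ) : etaR F n r k =
    ∑ m : Matrix (Fin n) (Fin n) F, (cst F k n r * co k r m) • MonoidAlgebra.single m (1 : k) := by
  classical
  unfold etaR
  rw [Finset.smul_sum]
  refine Finset.sum_congr rfl fun m _ => ?_
  rw [mul_smul (cst F k n r), cst]
  congr 1
  unfold co wt
  by_cases h1 : IsSemiIdempotent m <;> by_cases h2 : m.rank ≤ r <;>
    simp [h1, h2, qbinomEval_eq]

end main

/-- The unit formula: for `0 ≤ r ≤ n-1` and `q = #F` invertible in `k`, the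
element `η_r` is the two-sided unit of the ideal `a_{n,r} ⊆ k[M_n]` spanned by
matrices of rank at most `r`. -/
theorem etaR_is_unit (F : Type*) [Field F] [Fintype F] (n r : ℕ) (hr : r + 1 ≤ n)
    (k : Type*) [Field k] (hq : (Fintype.card F : k) ≠ 0) :
    ∀ x ∈ Submodule.span k
        {y : MonoidAlgebra k (Matrix (Fin n) (Fin n) F) |
          ∃ m : Matrix (Fin n) (Fin n) F, Matrix.rank m ≤ r ∧
            y = MonoidAlgebra.single m (1 : k)},
      etaR F n r k * x = x ∧ x * etaR F n r k = x := by
  intro x hx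
  induction hx using Submodule.span_induction with
  | mem y hy =>
    obtain ⟨m, hm, rfl⟩ := hy
    rw [etaR_eq]
    constructor
    · rw [Finset.sum_mul]
      refine Eq.trans ?_ (left_unit k hq r hr (fun m => MonoidAlgebra.single m (1 : k)) m hm)
      refine Finset.sum_congr rfl fun a _ => ?_
      rw [smul_mul_assoc, MonoidAlgebra.single_mul_single, one_mul]
    · rw [Finset.mul_sum]
      have h := left_unit k hq r hr (fun m => MonoidAlgebra.single mᵀ (1 : k)) mᵀ
        (by rw [Matrix.rank_transpose]; exact hm)
      rw [Matrix.transpose_transpose] at h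
      refine Eq.trans ?_ h
      rw [← Equiv.sum_comp (Matrix.transposeAddEquiv (Fin n) (Fin n) F).toEquiv]
      refine Finset.sum_congr rfl fun a _ => ?_
      simp only [AddEquiv.toEquiv_eq_coe, AddEquiv.coe_toEquiv, Matrix.transposeAddEquiv_apply]
      rw [mul_smul_comm, MonoidAlgebra.single_mul_single, one_mul, co_transpose,
        Matrix.transpose_mul, Matrix.transpose_transpose]
  | zero => simp
  | add a b _ _ ha hb =>
    rw [mul_add, add_mul, ha.1, ha.2, hb.1, hb.2]
    exact ⟨rfl, rfl⟩
  | smul c a _ ha =>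
    rw [mul_smul_comm, smul_mul_assoc, ha.1, ha.2]
    exact ⟨rfl, rfl⟩
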